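/- arXiv:2009.11231 — 6 statements merged into one kernel-verified Lean document; each statement's English description precedes it below -/
import Mathlib

section
/- Let Φ, Ψ be real N×q matrices such that ΦᵀΨ is invertible, and suppose ΦᵀΨ = U Σ Vᵀ with U, V ∈ O(q) orthogonal and Σ diagonal with strictly positive diagonal entries. Then for every orthogonal matrix Q' ∈ O(q), trace(ΦᵀΨQ') ≤ trace(Σ). -/
open Matrix

/-- With an SVD `ΦᵀΨ = U Σ Vᵀ` (`Σ = diagonal d`, `d > 0`), for every
orthogonal `Q' ∈ O(q)` one has `trace (ΦᵀΨ Q') ≤ trace Σ`. -/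
theorem trace_le_trace_singular_values (N q : ℕ)
    (Φ Ψ : Matrix (Fin N) (Fin q) ℝ) (h : IsUnit (Φᵀ * Ψ))
    (U V : Matrix (Fin q) (Fin q) ℝ) (d : Fin q → ℝ)
    (hU : Uᵀ * U = 1) (hV : Vᵀ * V = 1) (hd : ∀ i, 0 < d i)
    (hSVD : Φᵀ * Ψ = U * Matrix.diagonal d * Vᵀ) :
    ∀ Q' : Matrix (Fin q) (Fin q) ℝ, Q'ᵀ * Q' = 1 →
      Matrix.trace (Φᵀ * Ψ * Q') ≤ Matrix.trace (Matrix.diagonal d) := by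
  intro Q' hQ
  have hV' : V * Vᵀ = 1 := mul_eq_one_comm.mp hV
  have hW : (Vᵀ * Q' * U)ᵀ * (Vᵀ * Q' * U) = 1 := by
    calc (Vᵀ * Q' * U)ᵀ * (Vᵀ * Q' * U)
        = Uᵀ * (Q'ᵀ * (V * Vᵀ) * Q') * U := by
          simp only [transpose_mul, transpose_transpose, Matrix.mul_assoc]
      _ = 1 := by rw [hV', Matrix.mul_one, hQ, Matrix.mul_one, hU]
  have hW' : Vᵀ * Q' * U ∈ Matrix.unitaryGroup (Fin q) ℝ := by
    rwa [mem_unitaryGroup_iff', star_eq_conjTranspose, conjTranspose_eq_transpose_of_trivial]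
  calc trace (Φᵀ * Ψ * Q') = trace (diagonal d * (Vᵀ * Q' * U)) := by
        rw [hSVD, Matrix.mul_assoc, Matrix.mul_assoc, trace_mul_comm]
        simp only [Matrix.mul_assoc]
    _ ≤ trace (diagonal d) := by
        simp only [trace, diag_apply, diagonal_mul, diagonal_apply_eq]
        exact Finset.sum_le_sum fun i _ => mul_le_of_le_one_right (hd i).le
          ((Real.le_norm_self _).trans (entry_norm_bound_of_unitary hW' i i))
end

section
/- Let Φ, Ψ be real N×q matrices such that ΦᵀΨ is invertible, and suppose ΦᵀΨ = U Σ Vᵀ with U, V ∈ O(q) orthogonal and Σ diagonal with strictly positive diagonal entries. Set Q := V Uᵀ. Then for every orthogonal matrix Q' ∈ O(q) with Q' ≠ Q, the strict inequality ‖ΨQ − Φ‖_F < ‖ΨQ' − Φ‖_F holds; that is, Q = VUᵀ is the unique minimizer over O(q) of Q' ↦ ‖ΨQ' − Φ‖_F. -/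
open Matrix

/-- The Frobenius norm of a real matrix, `‖A‖_F = sqrt (trace (Aᵀ A))`. -/
noncomputable def frobNorm {N q : ℕ} (A : Matrix (Fin N) (Fin q) ℝ) : ℝ :=
  Real.sqrt (Matrix.trace (Aᵀ * A))

/-- For orthogonal `Q`, `‖ΨQ − Φ‖_F²` depends on `Q` only through `trace (ΦᵀΨQ)`. -/
lemma trace_mul_sub_transpose_mul_self {m n : Type*} [Fintype m] [Fintype n] [DecidableEq n]
    (Φ Ψ : Matrix m n ℝ) {Q : Matrix n n ℝ} (hQ : Qᵀ * Q = 1) :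
    trace ((Ψ * Q - Φ)ᵀ * (Ψ * Q - Φ)) =
      trace (Ψᵀ * Ψ) + trace (Φᵀ * Φ) - 2 * trace (Φᵀ * Ψ * Q) := by
  have hQ' : Q * Qᵀ = 1 := mul_eq_one_comm.mp hQ
  have h₁ : trace ((Ψ * Q)ᵀ * (Ψ * Q)) = trace (Ψᵀ * Ψ) := by
    rw [transpose_mul, Matrix.mul_assoc, trace_mul_comm, Matrix.mul_assoc, Matrix.mul_assoc, hQ',
      Matrix.mul_one]
  have h₂ : trace ((Ψ * Q)ᵀ * Φ) = trace (Φᵀ * Ψ * Q) := by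
    rw [← trace_transpose, transpose_mul, transpose_transpose, Matrix.mul_assoc]
  rw [transpose_sub, Matrix.sub_mul, Matrix.mul_sub, Matrix.mul_sub, trace_sub, trace_sub,
    trace_sub, h₁, h₂, ← Matrix.mul_assoc]
  ring

/-- Among orthogonal matrices, the identity is the only maximizer of `W ↦ trace (diagonal d * W)`
when `d` is positive. -/
lemma trace_diagonal_mul_lt_of_orthogonal {n : Type*} [Fintype n] [DecidableEq n]
    {d : n → ℝ} (hd : ∀ i, 0 < d i) {W : Matrix n n ℝ} (hW : Wᵀ * W = 1) (hne : W ≠ 1) :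
    trace (diagonal d * W) < trace (diagonal d) := by
  have key (i : n) : ∑ j, (W - 1) j i ^ 2 = 2 * (1 - W i i) := by
    have h : (W - 1)ᵀ * (W - 1) = 1 - Wᵀ - W + 1 := by
      rw [transpose_sub, transpose_one, Matrix.sub_mul, Matrix.mul_sub, hW]
      simp only [Matrix.mul_one, Matrix.one_mul]
      abel
    have h' := congrFun (congrFun h i) i
    simp only [mul_apply, transpose_apply,
      Matrix.add_apply, Matrix.sub_apply, one_apply_eq] at h'
    simp only [Matrix.sub_apply, pow_two]
    linarith
  have hle (i : n) : W i i ≤ 1 := by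
    have := Finset.sum_nonneg fun j (_ : j ∈ Finset.univ) => sq_nonneg ((W - 1) j i)
    linarith [key i]
  obtain ⟨j, i, hji⟩ : ∃ j i, (W - 1) j i ≠ 0 := by
    by_contra! h
    exact hne (sub_eq_zero.mp (Matrix.ext h))
  have hlt : W i i < 1 := by
    have := Finset.sum_pos' (fun j (_ : j ∈ Finset.univ) => sq_nonneg ((W - 1) j i))
      ⟨j, Finset.mem_univ j, by positivity⟩
    linarith [key i]
  simp only [trace, diag_apply, diagonal_mul, diagonal_apply_eq]
  exact Finset.sum_lt_sum (fun k _ => mul_le_of_le_one_right (hd k).le (hle k))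
    ⟨i, Finset.mem_univ i, mul_lt_of_lt_one_right (hd i) hlt⟩

/-- With an SVD `ΦᵀΨ = U Σ Vᵀ` and `Q := V Uᵀ`, the matrix `Q` is the
*unique* minimizer over `O(q)` of `Q' ↦ ‖ΨQ' − Φ‖_F`: for every orthogonal `Q' ≠ Q`,
`‖ΨQ − Φ‖_F < ‖ΨQ' − Φ‖_F`. -/
theorem frobNorm_polar_factor_strict_min (N q : ℕ)
    (Φ Ψ : Matrix (Fin N) (Fin q) ℝ) (h : IsUnit (Φᵀ * Ψ))
    (U V : Matrix (Fin q) (Fin q) ℝ) (d : Fin q → ℝ)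
    (hU : Uᵀ * U = 1) (hV : Vᵀ * V = 1) (hd : ∀ i, 0 < d i)
    (hSVD : Φᵀ * Ψ = U * Matrix.diagonal d * Vᵀ) :
    ∀ Q' : Matrix (Fin q) (Fin q) ℝ, Q'ᵀ * Q' = 1 → Q' ≠ V * Uᵀ →
      frobNorm (Ψ * (V * Uᵀ) - Φ) < frobNorm (Ψ * Q' - Φ) := by
  intro Q' hQ' hne
  have hU' : U * Uᵀ = 1 := mul_eq_one_comm.mp hU
  have hV' : V * Vᵀ = 1 := mul_eq_one_comm.mp hV
  have hQ : (V * Uᵀ)ᵀ * (V * Uᵀ) = 1 := by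
    rw [transpose_mul, transpose_transpose, Matrix.mul_assoc, ← Matrix.mul_assoc Vᵀ, hV,
      Matrix.one_mul, hU']
  have htrace (Q : Matrix (Fin q) (Fin q) ℝ) :
      trace (Φᵀ * Ψ * Q) = trace (diagonal d * (Vᵀ * Q * U)) := by
    rw [hSVD, Matrix.mul_assoc, Matrix.mul_assoc, trace_mul_comm]
    simp only [Matrix.mul_assoc]
  have hW : (Vᵀ * Q' * U)ᵀ * (Vᵀ * Q' * U) = 1 := by
    calc (Vᵀ * Q' * U)ᵀ * (Vᵀ * Q' * U) = Uᵀ * (Q'ᵀ * (V * Vᵀ) * Q') * U := by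
          simp only [transpose_mul, transpose_transpose, Matrix.mul_assoc]
      _ = 1 := by rw [hV', Matrix.mul_one, hQ', Matrix.mul_one, hU]
  have hW_ne : Vᵀ * Q' * U ≠ 1 := by
    intro hW_one
    apply hne
    calc Q' = (V * Vᵀ) * Q' * (U * Uᵀ) := by rw [hV', hU', Matrix.one_mul, Matrix.mul_one]
      _ = V * (Vᵀ * Q' * U) * Uᵀ := by simp only [Matrix.mul_assoc]
      _ = V * Uᵀ := by rw [hW_one, Matrix.mul_one]
  have hW_opt : Vᵀ * (V * Uᵀ) * U = 1 := by
    rw [← Matrix.mul_assoc, hV, Matrix.one_mul, hU]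
  have hlt := trace_diagonal_mul_lt_of_orthogonal hd hW hW_ne
  have hnonneg : 0 ≤ trace ((Ψ * (V * Uᵀ) - Φ)ᵀ * (Ψ * (V * Uᵀ) - Φ)) := by
    simp only [trace, diag_apply, mul_apply, transpose_apply]
    exact Finset.sum_nonneg fun _ _ => Finset.sum_nonneg fun _ _ => mul_self_nonneg _
  apply Real.sqrt_lt_sqrt hnonneg
  rw [trace_mul_sub_transpose_mul_self Φ Ψ hQ, trace_mul_sub_transpose_mul_self Φ Ψ hQ',
    htrace, htrace, hW_opt, Matrix.mul_one]
  linarith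
end

section
/- Let Φ, Ψ be real N×q matrices such that ΦᵀΨ is invertible. If ΦᵀΨ = U₁ Σ₁ V₁ᵀ and ΦᵀΨ = U₂ Σ₂ V₂ᵀ are two factorizations with U₁, V₁, U₂, V₂ ∈ O(q) orthogonal and Σ₁, Σ₂ diagonal with strictly positive diagonal entries, then V₁U₁ᵀ = V₂U₂ᵀ. Consequently the matrix Q = VUᵀ appearing in the logarithmic map does not depend on the choice of singular value decomposition of ΦᵀΨ. -/
open Matrix

/-- Two matrices intertwining a pair of positive diagonal matrices in both orders agree. -/
theorem eq_of_diagonal_mul_eq_mul_diagonal {m n : Type*} [Fintype m] [Fintype n]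
    [DecidableEq m] [DecidableEq n] {P R : Matrix m n ℝ} {d : m → ℝ} {e : n → ℝ}
    (hd : ∀ i, 0 < d i) (he : ∀ j, 0 < e j)
    (hR : diagonal d * R = P * diagonal e) (hP : diagonal d * P = R * diagonal e) :
    P = R := by
  ext i j
  have h₁ := congrFun₂ hR i j
  have h₂ := congrFun₂ hP i j
  rw [diagonal_mul, mul_diagonal] at h₁ h₂
  have hpos := add_pos (hd i) (he j)
  exact mul_left_cancel₀ hpos.ne' (by linear_combination h₂ - h₁)

/-- Two singular value decompositions of one matrix are intertwined by the change of singular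
vectors. -/
theorem diagonal_mul_eq_mul_diagonal_of_svd_eq {n : Type*} [Fintype n] [DecidableEq n]
    {U₁ V₁ U₂ V₂ : Matrix n n ℝ} {d₁ d₂ : n → ℝ}
    (hU₁ : U₁ᵀ * U₁ = 1) (hV₂ : V₂ᵀ * V₂ = 1)
    (h : U₁ * diagonal d₁ * V₁ᵀ = U₂ * diagonal d₂ * V₂ᵀ) :
    diagonal d₁ * (V₁ᵀ * V₂) = U₁ᵀ * U₂ * diagonal d₂ :=
  calc diagonal d₁ * (V₁ᵀ * V₂) = (U₁ᵀ * U₁) * diagonal d₁ * (V₁ᵀ * V₂) := by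
        rw [hU₁, Matrix.one_mul]
    _ = U₁ᵀ * (U₁ * diagonal d₁ * V₁ᵀ) * V₂ := by simp only [Matrix.mul_assoc]
    _ = U₁ᵀ * U₂ * diagonal d₂ * (V₂ᵀ * V₂) := by rw [h]; simp only [Matrix.mul_assoc]
    _ = U₁ᵀ * U₂ * diagonal d₂ := by rw [hV₂, Matrix.mul_one]

/-- The matrix `Q = V Uᵀ` appearing in the logarithmic map does not depend
on the choice of singular value decomposition of the invertible matrix `ΦᵀΨ`. -/
theorem polar_factor_svd_independent (N q : ℕ)
    (Φ Ψ : Matrix (Fin N) (Fin q) ℝ) (h : IsUnit (Φᵀ * Ψ))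
    (U₁ V₁ U₂ V₂ : Matrix (Fin q) (Fin q) ℝ) (d₁ d₂ : Fin q → ℝ)
    (hU₁ : U₁ᵀ * U₁ = 1) (hV₁ : V₁ᵀ * V₁ = 1)
    (hU₂ : U₂ᵀ * U₂ = 1) (hV₂ : V₂ᵀ * V₂ = 1)
    (hd₁ : ∀ i, 0 < d₁ i) (hd₂ : ∀ i, 0 < d₂ i)
    (hSVD₁ : Φᵀ * Ψ = U₁ * Matrix.diagonal d₁ * V₁ᵀ)
    (hSVD₂ : Φᵀ * Ψ = U₂ * Matrix.diagonal d₂ * V₂ᵀ) :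
    V₁ * U₁ᵀ = V₂ * U₂ᵀ := by
  have hA := hSVD₁.symm.trans hSVD₂
  have hAt : V₁ * diagonal d₁ * U₁ᵀ = V₂ * diagonal d₂ * U₂ᵀ := by
    simpa [transpose_mul, Matrix.mul_assoc] using congrArg transpose hA
  have hUV : U₁ᵀ * U₂ = V₁ᵀ * V₂ := eq_of_diagonal_mul_eq_mul_diagonal hd₁ hd₂
    (diagonal_mul_eq_mul_diagonal_of_svd_eq hU₁ hV₂ hA)
    (diagonal_mul_eq_mul_diagonal_of_svd_eq hV₁ hU₂ hAt)
  calc V₁ * U₁ᵀ = V₁ * (U₁ᵀ * U₂) * U₂ᵀ := by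
        rw [Matrix.mul_assoc, Matrix.mul_assoc, mul_eq_one_comm.mp hU₂, Matrix.mul_one]
    _ = V₁ * V₁ᵀ * V₂ * U₂ᵀ := by rw [hUV]; simp only [Matrix.mul_assoc]
    _ = V₂ * U₂ᵀ := by rw [mul_eq_one_comm.mp hV₁, Matrix.one_mul]
end

section
/- Let Φ, Ψ be real N×q matrices such that ΦᵀΨ is invertible, and suppose ΦᵀΨ = U Σ Vᵀ with U, V ∈ O(q) orthogonal and Σ diagonal with strictly positive diagonal entries. Set Q := V Uᵀ and ξ := ΨQ − Φ. Then the q×q matrix Φᵀξ is symmetric. -/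
open Matrix

/-- With an SVD `ΦᵀΨ = U Σ Vᵀ`, `Q := V Uᵀ` and `ξ := ΨQ − Φ`, the matrix
`Φᵀξ` is symmetric; i.e. the logarithm `Log_{π(Φ)} π(Ψ)` is a horizontal vector at `Φ`. -/
theorem log_is_horizontal (N q : ℕ)
    (Φ Ψ : Matrix (Fin N) (Fin q) ℝ) (h : IsUnit (Φᵀ * Ψ))
    (U V : Matrix (Fin q) (Fin q) ℝ) (d : Fin q → ℝ)
    (hU : Uᵀ * U = 1) (hV : Vᵀ * V = 1) (hd : ∀ i, 0 < d i)
    (hSVD : Φᵀ * Ψ = U * Matrix.diagonal d * Vᵀ) :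
    (Φᵀ * (Ψ * (V * Uᵀ) - Φ))ᵀ = Φᵀ * (Ψ * (V * Uᵀ) - Φ) := by
  have key : Φᵀ * (Ψ * (V * Uᵀ) - Φ) = U * Matrix.diagonal d * Uᵀ - Φᵀ * Φ := by
    calc Φᵀ * (Ψ * (V * Uᵀ) - Φ) = Φᵀ * Ψ * (V * Uᵀ) - Φᵀ * Φ := by
          rw [Matrix.mul_sub, Matrix.mul_assoc]
      _ = U * Matrix.diagonal d * (Vᵀ * V) * Uᵀ - Φᵀ * Φ := by
          rw [hSVD]; simp only [Matrix.mul_assoc]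
      _ = U * Matrix.diagonal d * Uᵀ - Φᵀ * Φ := by rw [hV, Matrix.mul_one]
  rw [key]
  simp [Matrix.transpose_mul, Matrix.mul_assoc]
end

section
/- Let N ≥ q and let Φ, Ψ be real N×q matrices of rank q such that ΦᵀΨ is invertible, and suppose ΦᵀΨ = U Σ Vᵀ with U, V ∈ O(q) orthogonal and Σ diagonal with strictly positive diagonal entries. Set Q := V Uᵀ and ξ := ΨQ − Φ. Then for every t ∈ [0, 1], the matrix Φ + tξ has rank q. -/
open Matrix

/-- With `Φ, Ψ` of rank `q`, `ΦᵀΨ` invertible, an SVD `ΦᵀΨ = U Σ Vᵀ`,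
`Q := V Uᵀ` and `ξ := ΨQ − Φ`, the segment `t ↦ Φ + tξ` stays of full rank `q` for
`t ∈ [0, 1]`; i.e. the logarithm belongs to the set `D_Φ` of allowed horizontal vectors. -/
theorem log_segment_full_rank (N q : ℕ) (hNq : q ≤ N)
    (Φ Ψ : Matrix (Fin N) (Fin q) ℝ)
    (hrankΦ : Φ.rank = q) (hrankΨ : Ψ.rank = q)
    (h : IsUnit (Φᵀ * Ψ))
    (U V : Matrix (Fin q) (Fin q) ℝ) (d : Fin q → ℝ)
    (hU : Uᵀ * U = 1) (hV : Vᵀ * V = 1) (hd : ∀ i, 0 < d i)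
    (hSVD : Φᵀ * Ψ = U * Matrix.diagonal d * Vᵀ) :
    ∀ t : ℝ, t ∈ Set.Icc (0 : ℝ) 1 →
      (Φ + t • (Ψ * (V * Uᵀ) - Φ)).rank = q := by
  rintro t ⟨ht0, ht1⟩
  rcases ht0.eq_or_lt with rfl | ht
  · simpa using hrankΦ
  have hprod : Φᵀ * (Φ + t • (Ψ * (V * Uᵀ) - Φ)) =
      t • (U * diagonal d * Uᵀ) + (1 - t) • (Φᵀ * Φ) := by
    have hpolar : Φᵀ * (Ψ * (V * Uᵀ)) = U * diagonal d * Uᵀ := by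
      rw [← Matrix.mul_assoc, hSVD, Matrix.mul_assoc, ← Matrix.mul_assoc Vᵀ, hV, Matrix.one_mul]
    rw [Matrix.mul_add, Matrix.mul_smul, Matrix.mul_sub, hpolar]
    module
  have hUunit : IsUnit U := IsUnit.of_mul_eq_one Uᵀ (mul_eq_one_comm.mp hU)
  have hpos : (U * diagonal d * Uᵀ).PosDef := by
    simpa using (PosDef.diagonal hd).mul_mul_conjTranspose_same
      (vecMul_injective_of_isUnit hUunit)
  have hgram : (Φᵀ * Φ).PosSemidef := by
    simpa using posSemidef_conjTranspose_mul_self Φ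
  have hunit : IsUnit (Φᵀ * (Φ + t • (Ψ * (V * Uᵀ) - Φ))) := by
    rw [hprod]
    exact ((hpos.smul ht).add_posSemidef (hgram.smul (sub_nonneg.mpr ht1))).isUnit
  refine le_antisymm (by simpa using rank_le_width _) ?_
  calc
    q = (Φᵀ * (Φ + t • (Ψ * (V * Uᵀ) - Φ))).rank := by
      rw [rank_of_isUnit _ hunit, Fintype.card_fin]
    _ ≤ _ := rank_mul_le_right _ _
end

section
/- Let Ψ be a real N×q matrix and define f : ℝ^{N×q} → ℝ by f(Φ) = inf over Q ∈ O(q) of ‖ΨQ − Φ‖_F². Let Φ be such that ΦᵀΨ is invertible, let ΦᵀΨ = U Σ Vᵀ be a singular value decomposition with U, V ∈ O(q) orthogonal and Σ diagonal with strictly positive diagonal entries, and set Q̃ := V Uᵀ. Then f is differentiable at Φ and its (Fréchet) derivative at Φ is the linear map ξ ↦ 2·trace((Φ − ΨQ̃)ᵀ ξ); equivalently, the gradient of f with respect to the Frobenius inner product is 2(Φ − ΨQ̃). -/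
open Matrix

attribute [local instance] Matrix.frobeniusNormedAddCommGroup Matrix.frobeniusNormedSpace

section FrobeniusTrace

variable {m n : ℕ}

theorem trace_transpose_mul_self_eq_sum (A : Matrix (Fin m) (Fin n) ℝ) :
    trace (Aᵀ * A) = ∑ i, ∑ j, A i j ^ 2 := by
  rw [Finset.sum_comm]
  simp only [trace, diag_apply, mul_apply, transpose_apply, sq]

theorem trace_transpose_mul_self_nonneg (A : Matrix (Fin m) (Fin n) ℝ) :
    0 ≤ trace (Aᵀ * A) := by
  rw [trace_transpose_mul_self_eq_sum]
  positivity

theorem frobNorm_sq (A : Matrix (Fin m) (Fin n) ℝ) :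
    frobNorm A ^ 2 = trace (Aᵀ * A) :=
  Real.sq_sqrt (trace_transpose_mul_self_nonneg A)

theorem trace_transpose_mul_self_eq_norm_sq (A : Matrix (Fin m) (Fin n) ℝ) :
    trace (Aᵀ * A) = ‖A‖ ^ 2 := by
  have hs : (0 : ℝ) ≤ ∑ i, ∑ j, A i j ^ 2 := by positivity
  rw [trace_transpose_mul_self_eq_sum, frobenius_norm_def, ← Real.sqrt_eq_rpow]
  simp only [Real.rpow_two, Real.norm_eq_abs, sq_abs]
  exact (Real.sq_sqrt hs).symm

theorem trace_transpose_mul_comm (A B : Matrix (Fin m) (Fin n) ℝ) :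
    trace (Aᵀ * B) = trace (Bᵀ * A) := by
  rw [← trace_transpose, transpose_mul, transpose_transpose]

theorem trace_sub_transpose_mul_sub (A B : Matrix (Fin m) (Fin n) ℝ) :
    trace ((A - B)ᵀ * (A - B)) =
      trace (Aᵀ * A) - 2 * trace (Bᵀ * A) + trace (Bᵀ * B) := by
  simp only [transpose_sub, Matrix.sub_mul, Matrix.mul_sub, trace_sub]
  rw [trace_transpose_mul_comm A B]
  ring

/-- The Frobenius pairing with a fixed matrix, as a continuous linear functional. -/
noncomputable def frobPairing (A : Matrix (Fin m) (Fin n) ℝ) :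
    Matrix (Fin m) (Fin n) ℝ →L[ℝ] ℝ :=
  LinearMap.toContinuousLinearMap
    ((traceLinearMap (Fin n) ℝ ℝ).comp (mulLeftLinearMap (Fin n) ℝ Aᵀ))

end FrobeniusTrace

section Procrustes

variable {N q : ℕ}

theorem diag_le_one_of_transpose_mul_self {W : Matrix (Fin q) (Fin q) ℝ}
    (hW : Wᵀ * W = 1) (i : Fin q) : W i i ≤ 1 := by
  have hcol : ∑ j, W j i * W j i = 1 := by
    simpa [mul_apply] using congrFun (congrFun hW i) i
  have hle : W i i * W i i ≤ ∑ j, W j i * W j i :=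
    Finset.single_le_sum (f := fun j => W j i * W j i)
      (fun j _ => mul_self_nonneg (W j i)) (Finset.mem_univ i)
  nlinarith

theorem transpose_mul_self_mul_transpose {U V : Matrix (Fin q) (Fin q) ℝ}
    (hU : Uᵀ * U = 1) (hV : Vᵀ * V = 1) : (V * Uᵀ)ᵀ * (V * Uᵀ) = 1 := by
  calc (V * Uᵀ)ᵀ * (V * Uᵀ) = U * (Vᵀ * V) * Uᵀ := by
        simp only [transpose_mul, transpose_transpose, Matrix.mul_assoc]
    _ = 1 := by rw [hV, Matrix.mul_one, mul_eq_one_comm.mp hU]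

/-- Quadratic growth of the trace functional `Q ↦ trace (A Q)` on the orthogonal group, away from
its maximiser `V Uᵀ`, where `A = U diag(d) Vᵀ`. -/
theorem trace_mul_orthogonal_add_le {U V Q A : Matrix (Fin q) (Fin q) ℝ} {d : Fin q → ℝ} {c : ℝ}
    (hU : Uᵀ * U = 1) (hV : Vᵀ * V = 1) (hQ : Qᵀ * Q = 1) (hc : ∀ i, c ≤ d i)
    (hA : A = U * diagonal d * Vᵀ) :
    2 * trace (A * Q) + c * trace ((Q - V * Uᵀ)ᵀ * (Q - V * Uᵀ)) ≤
      2 * trace (A * (V * Uᵀ)) := by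
  have hV' : V * Vᵀ = 1 := mul_eq_one_comm.mp hV
  set W := Vᵀ * Q * U with hW
  have hWW : Wᵀ * W = 1 := by
    calc Wᵀ * W = Uᵀ * (Qᵀ * (V * Vᵀ) * Q) * U := by
          simp only [hW, transpose_mul, transpose_transpose, Matrix.mul_assoc]
      _ = 1 := by rw [hV', Matrix.mul_one, hQ, Matrix.mul_one, hU]
  have hAQ : trace (A * Q) = ∑ i, d i * W i i := by
    calc trace (A * Q) = trace (U * (diagonal d * (Vᵀ * Q))) := by
          rw [hA]; simp only [Matrix.mul_assoc]
      _ = trace (diagonal d * W) := by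
          rw [trace_mul_comm, hW]; simp only [Matrix.mul_assoc]
      _ = _ := by simp [trace, diagonal_mul]
  have hAM : trace (A * (V * Uᵀ)) = ∑ i, d i := by
    calc trace (A * (V * Uᵀ)) = trace (U * (diagonal d * (Vᵀ * V) * Uᵀ)) := by
          rw [hA]; simp only [Matrix.mul_assoc]
      _ = ∑ i, d i := by
          rw [trace_mul_comm, hV, Matrix.mul_one, Matrix.mul_assoc, hU, Matrix.mul_one,
            trace_diagonal]
  have hM := transpose_mul_self_mul_transpose hU hV
  have hMQ : trace ((V * Uᵀ)ᵀ * Q) = ∑ i, W i i := by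
    rw [transpose_mul, transpose_transpose, Matrix.mul_assoc, trace_mul_comm]
    rfl
  have hE : trace ((Q - V * Uᵀ)ᵀ * (Q - V * Uᵀ)) = ∑ i, 2 * (1 - W i i) := by
    rw [trace_sub_transpose_mul_sub, hQ, hM, hMQ, ← Finset.mul_sum, Finset.sum_sub_distrib]
    simp only [trace_one, Fintype.card_fin, Finset.sum_const, Finset.card_univ, nsmul_eq_mul]
    ring
  rw [hAQ, hAM, hE, Finset.mul_sum, Finset.mul_sum, Finset.mul_sum, ← Finset.sum_add_distrib]
  refine Finset.sum_le_sum fun i _ => ?_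
  nlinarith [mul_nonneg (sub_nonneg.mpr (hc i))
    (sub_nonneg.mpr (diag_le_one_of_transpose_mul_self hWW i))]

/-- Expansion of the Procrustes residual at an orthogonal matrix. -/
theorem frobNorm_mul_sub_sq (Ψ X : Matrix (Fin N) (Fin q) ℝ) {Q : Matrix (Fin q) (Fin q) ℝ}
    (hQ : Qᵀ * Q = 1) :
    frobNorm (Ψ * Q - X) ^ 2 =
      trace (Ψᵀ * Ψ) - 2 * trace (Xᵀ * (Ψ * Q)) + trace (Xᵀ * X) := by
  have hQ' : Q * Qᵀ = 1 := mul_eq_one_comm.mp hQ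
  have hΨ : trace ((Ψ * Q)ᵀ * (Ψ * Q)) = trace (Ψᵀ * Ψ) := by
    rw [transpose_mul, Matrix.mul_assoc, trace_mul_comm, Matrix.mul_assoc, Matrix.mul_assoc,
      hQ', Matrix.mul_one]
  rw [frobNorm_sq, trace_sub_transpose_mul_sub, hΨ]

/-- Lower bound for the Procrustes residual of a perturbation `Φ + ξ`, uniform over the orthogonal
group. -/
theorem frobNorm_mul_sub_add_sq_ge {Ψ Φ : Matrix (Fin N) (Fin q) ℝ}
    {U V Q : Matrix (Fin q) (Fin q) ℝ} {d : Fin q → ℝ} {c : ℝ} (hc : 0 < c)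
    (hU : Uᵀ * U = 1) (hV : Vᵀ * V = 1) (hQ : Qᵀ * Q = 1) (hd : ∀ i, c ≤ d i)
    (hSVD : Φᵀ * Ψ = U * diagonal d * Vᵀ) (ξ : Matrix (Fin N) (Fin q) ℝ) :
    frobNorm (Ψ * (V * Uᵀ) - (Φ + ξ)) ^ 2 - c⁻¹ * (‖Ψᵀ‖ ^ 2 * ‖ξ‖ ^ 2) ≤
      frobNorm (Ψ * Q - (Φ + ξ)) ^ 2 := by
  have hM := transpose_mul_self_mul_transpose hU hV
  have hgrow := trace_mul_orthogonal_add_le hU hV hQ hd hSVD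
  set M := V * Uᵀ
  set E := Q - M with hE
  have hsq : 0 ≤ c ^ 2 * trace (Eᵀ * E) - 2 * (c * trace ((Ψᵀ * ξ)ᵀ * E))
      + trace ((Ψᵀ * ξ)ᵀ * (Ψᵀ * ξ)) := by
    have := trace_transpose_mul_self_nonneg (c • E - Ψᵀ * ξ)
    rw [trace_sub_transpose_mul_sub] at this
    simp only [transpose_smul, Matrix.smul_mul, Matrix.mul_smul, trace_smul, smul_eq_mul] at this
    linarith
  have hnorm : trace ((Ψᵀ * ξ)ᵀ * (Ψᵀ * ξ)) ≤ ‖Ψᵀ‖ ^ 2 * ‖ξ‖ ^ 2 := by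
    rw [trace_transpose_mul_self_eq_norm_sq, ← mul_pow]
    exact pow_le_pow_left₀ (norm_nonneg _) (frobenius_norm_mul _ _) 2
  have hpair : trace ((Ψᵀ * ξ)ᵀ * E) = trace (ξᵀ * (Ψ * Q)) - trace (ξᵀ * (Ψ * M)) := by
    rw [transpose_mul, transpose_transpose, hE, Matrix.mul_sub, trace_sub, Matrix.mul_assoc,
      Matrix.mul_assoc]
  have hdiv : 0 ≤ c * trace (Eᵀ * E) - 2 * trace ((Ψᵀ * ξ)ᵀ * E)
      + c⁻¹ * (‖Ψᵀ‖ ^ 2 * ‖ξ‖ ^ 2) := by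
    calc (0 : ℝ) ≤ c⁻¹ * (c ^ 2 * trace (Eᵀ * E) - 2 * (c * trace ((Ψᵀ * ξ)ᵀ * E))
          + ‖Ψᵀ‖ ^ 2 * ‖ξ‖ ^ 2) := mul_nonneg (inv_nonneg.mpr hc.le) (by linarith)
      _ = _ := by field_simp
  rw [frobNorm_mul_sub_sq _ _ hQ, frobNorm_mul_sub_sq _ _ hM]
  rw [Matrix.mul_assoc, Matrix.mul_assoc] at hgrow
  simp only [transpose_add, Matrix.add_mul, trace_add]
  linarith

end Procrustes

/-- The squared-distance function
`f(Φ) = inf_{Q ∈ O(q)} ‖ΨQ − Φ‖_F²` is differentiable at any `Φ` with `ΦᵀΨ` invertible,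
with Fréchet derivative `ξ ↦ 2 trace((Φ − ΨQ̃)ᵀ ξ)` where `Q̃ = V Uᵀ` comes from an SVD
`ΦᵀΨ = U Σ Vᵀ`; equivalently its Frobenius gradient is `2(Φ − ΨQ̃)`. -/
theorem squared_dist_hasFDerivAt (N q : ℕ)
    (Ψ : Matrix (Fin N) (Fin q) ℝ)
    (f : Matrix (Fin N) (Fin q) ℝ → ℝ)
    (hf : ∀ X, f X = sInf ((fun Q : Matrix (Fin q) (Fin q) ℝ =>
      frobNorm (Ψ * Q - X) ^ 2) '' {Q | Qᵀ * Q = 1}))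
    (Φ : Matrix (Fin N) (Fin q) ℝ) (h : IsUnit (Φᵀ * Ψ))
    (U V : Matrix (Fin q) (Fin q) ℝ) (d : Fin q → ℝ)
    (hU : Uᵀ * U = 1) (hV : Vᵀ * V = 1) (hd : ∀ i, 0 < d i)
    (hSVD : Φᵀ * Ψ = U * Matrix.diagonal d * Vᵀ) :
    ∃ L : Matrix (Fin N) (Fin q) ℝ →L[ℝ] ℝ,
      (∀ ξ : Matrix (Fin N) (Fin q) ℝ,
        L ξ = 2 * Matrix.trace ((Φ - Ψ * (V * Uᵀ))ᵀ * ξ)) ∧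
      HasFDerivAt f L Φ := by
  obtain ⟨c, hc, hcd⟩ : ∃ c : ℝ, 0 < c ∧ ∀ i, c ≤ d i := by
    rcases isEmpty_or_nonempty (Fin q) with hq | hq
    · exact ⟨1, one_pos, fun i => hq.elim i⟩
    · obtain ⟨i, hi⟩ := Finite.exists_min d
      exact ⟨d i, hd i, hi⟩
  have hM := transpose_mul_self_mul_transpose hU hV
  have hupper (ξ) : f (Φ + ξ) ≤ frobNorm (Ψ * (V * Uᵀ) - (Φ + ξ)) ^ 2 := by
    rw [hf]
    refine csInf_le ⟨0, ?_⟩ ⟨_, hM, rfl⟩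
    rintro _ ⟨Q, -, rfl⟩
    positivity
  have hlower (ξ) : frobNorm (Ψ * (V * Uᵀ) - (Φ + ξ)) ^ 2 - c⁻¹ * (‖Ψᵀ‖ ^ 2 * ‖ξ‖ ^ 2)
      ≤ f (Φ + ξ) := by
    rw [hf]
    refine le_csInf ⟨_, _, hM, rfl⟩ ?_
    rintro _ ⟨Q, hQ, rfl⟩
    exact frobNorm_mul_sub_add_sq_ge hc hU hV hQ hcd hSVD ξ
  have hbase : f Φ = frobNorm (Ψ * (V * Uᵀ) - Φ) ^ 2 := by
    have h₁ := hupper 0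
    have h₂ := hlower 0
    simp only [add_zero, norm_zero, ne_eq, OfNat.ofNat_ne_zero, not_false_eq_true, zero_pow,
      mul_zero, sub_zero] at h₁ h₂
    exact le_antisymm h₁ h₂
  have hexpand (ξ) : frobNorm (Ψ * (V * Uᵀ) - (Φ + ξ)) ^ 2 = frobNorm (Ψ * (V * Uᵀ) - Φ) ^ 2
      + 2 * trace ((Φ - Ψ * (V * Uᵀ))ᵀ * ξ) + ‖ξ‖ ^ 2 := by
    rw [← sub_sub, frobNorm_sq, frobNorm_sq, trace_sub_transpose_mul_sub,
      trace_transpose_mul_self_eq_norm_sq ξ, trace_transpose_mul_comm ξ,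
      ← neg_sub Φ, transpose_neg, Matrix.neg_mul, trace_neg]
    simp only [Matrix.neg_mul, Matrix.mul_neg, neg_neg, trace_neg]
    ring
  refine ⟨(2 : ℝ) • frobPairing (Φ - Ψ * (V * Uᵀ)), fun ξ => rfl, ?_⟩
  refine hasFDerivAt_iff_isLittleO_nhds_zero.mpr ?_
  refine Asymptotics.IsBigO.trans_isLittleO (g := fun ξ => ‖ξ‖ ^ 2) ?_
    (Asymptotics.isLittleO_norm_pow_id one_lt_two)
  refine Asymptotics.IsBigO.of_bound (1 + c⁻¹ * ‖Ψᵀ‖ ^ 2) (Filter.Eventually.of_forall fun ξ => ?_)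
  have h₁ := hupper ξ
  have h₂ := hlower ξ
  rw [hexpand] at h₁ h₂
  have h₃ : 0 ≤ c⁻¹ * (‖Ψᵀ‖ ^ 2 * ‖ξ‖ ^ 2) := by positivity
  have h₄ : 0 ≤ ‖ξ‖ ^ 2 := by positivity
  change |f (Φ + ξ) - f Φ - 2 * trace ((Φ - Ψ * (V * Uᵀ))ᵀ * ξ)| ≤ _
  rw [hbase, Real.norm_of_nonneg h₄, abs_le]
  constructor <;> linarith
end
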